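/- arXiv:2107.13188 — 2 statements merged into one kernel-verified Lean document; each statement's English description precedes it below -/
import Mathlib

section
/- Let n ≥ 1, let Θ ∈ ℂ^{n×n} be symmetric with positive definite real part, and let ν ∈ ℕⁿ. Then for every r ∈ ℝⁿ the Hessian matrix of HG_Θ^ν at r equals: −Θ⁻¹·HG_Θ^ν(r) + 2·Θ⁻¹·( Φ_ν(r) − r·φ_ν(r)ᵀ − φ_ν(r)·rᵀ + (1/2)·r·rᵀ·HG_Θ^ν(r) )·Θ⁻¹. -/
open scoped BigOperators
open MeasureTheory Matrix

noncomputable section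

namespace AHGPaper

/-- Complex partial derivative in coordinate `j`. -/
def cpderiv {n : ℕ} (j : Fin n) (f : (Fin n → ℂ) → ℂ) : (Fin n → ℂ) → ℂ :=
  fun x => deriv (fun t : ℂ => f (Function.update x j t)) (x j)

/-- Mixed partial derivative of multi-order `ν`. -/
def mpderiv {n : ℕ} (ν : Fin n → ℕ) (f : (Fin n → ℂ) → ℂ) : (Fin n → ℂ) → ℂ :=
  (List.finRange n).foldr (fun j g => (cpderiv j)^[ν j] g) f

/-- The anisotropic Hermite-Gauss (AHG) function `HG_Θ^ν`. -/
def HG {n : ℕ} (Θ : Matrix (Fin n) (Fin n) ℂ) (ν : Fin n → ℕ) (r : Fin n → ℂ) : ℂ :=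
  (-(1 / (Real.sqrt 2 : ℂ))) ^ (∑ j, ν j) *
    ((∏ j, ((ν j).factorial : ℂ)) ^ (-(1 / 2 : ℂ))) *
    (((Real.pi : ℂ) ^ n * Θ.det) ^ (-(1 / 4 : ℂ))) *
    Complex.exp ((1 / 2 : ℂ) * (r ⬝ᵥ Θ⁻¹.mulVec r)) *
    mpderiv ν (fun x => Complex.exp (-(x ⬝ᵥ Θ⁻¹.mulVec x))) r

/-- The dual anisotropic Hermite-Gauss function `H̃G_Θ^ν`. -/
def HGd {n : ℕ} (Θ : Matrix (Fin n) (Fin n) ℂ) (ν : Fin n → ℕ) (r : Fin n → ℂ) : ℂ :=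
  (-(1 / (Real.sqrt 2 : ℂ))) ^ (∑ j, ν j) *
    ((∏ j, ((ν j).factorial : ℂ)) ^ (-(1 / 2 : ℂ))) *
    (((Real.pi : ℂ) ^ n * Θ.det) ^ (-(1 / 4 : ℂ))) *
    Complex.exp ((1 / 2 : ℂ) * ((Θ⁻¹.mulVec r) ⬝ᵥ Θ.mulVec (Θ⁻¹.mulVec r))) *
    mpderiv ν (fun x => Complex.exp (-(x ⬝ᵥ Θ.mulVec x))) (Θ⁻¹.mulVec r)

/-- Physicists' Hermite polynomial via Rodrigues' formula. -/
def hermiteH (k : ℕ) (z : ℂ) : ℂ :=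
  (-1) ^ k * Complex.exp (z ^ 2) * iteratedDeriv k (fun w => Complex.exp (-(w ^ 2))) z

/-- The `k`-th univariate Hermite-Gauss function `ψ_k`. -/
def psi (k : ℕ) (z : ℂ) : ℂ :=
  ((Real.sqrt Real.pi * 2 ^ k * k.factorial : ℝ) : ℂ) ^ (-(1 / 2 : ℂ)) *
    Complex.exp (-(z ^ 2) / 2) * hermiteH k z

/-- The vector `φ_ν(r)` whose `k`-th entry is `(1/√2)·√(ν_k)·HG_Θ^{ν-ε_k}(r)`. -/
def phiV {n : ℕ} (Θ : Matrix (Fin n) (Fin n) ℂ) (ν : Fin n → ℕ) (r : Fin n → ℂ) :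
    Fin n → ℂ :=
  fun k => (1 / (Real.sqrt 2 : ℂ)) * (Real.sqrt (ν k) : ℂ) *
    HG Θ (fun j => ν j - if j = k then 1 else 0) r

/-- The matrix `Φ_ν(r)`. -/
def PhiM {n : ℕ} (Θ : Matrix (Fin n) (Fin n) ℂ) (ν : Fin n → ℕ) (r : Fin n → ℂ) :
    Matrix (Fin n) (Fin n) ℂ :=
  Matrix.of fun j k =>
    if j = k then
      (Real.sqrt (ν j * (ν j - 1)) : ℂ) * HG Θ (fun l => ν l - if l = j then 2 else 0) r
    else
      (Real.sqrt (ν j * ν k) : ℂ) *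
        HG Θ (fun l => ν l - ((if l = j then 1 else 0) + (if l = k then 1 else 0))) r

/-- The `n`-dimensional linear canonical transform with parameter matrix `[[a,b],[c,d]]`. -/
def LCT {n : ℕ} (a b d : ℂ) (f : (Fin n → ℝ) → ℂ) (ζ : Fin n → ℝ) : ℂ :=
  (1 / (2 * (Real.pi : ℂ) * Complex.I * b)) ^ ((n : ℂ) / 2) *
    Complex.exp (Complex.I * d / (2 * b) * ((fun i => (ζ i : ℂ)) ⬝ᵥ fun i => (ζ i : ℂ))) *
    ∫ r : Fin n → ℝ, f r *
      Complex.exp (-(Complex.I / (2 * b)) *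
        ((fun i => (r i : ℂ)) ⬝ᵥ fun i => 2 * (ζ i : ℂ) - a * (r i : ℂ)))

/-- The `n`-dimensional Fourier transform `(2π)^{-n/2} ∫ f(r) e^{-i ζ·r} dr`. -/
def FT {n : ℕ} (f : (Fin n → ℝ) → ℂ) (ζ : Fin n → ℝ) : ℂ :=
  ((2 * Real.pi : ℝ) : ℂ) ^ (-(n : ℂ) / 2) *
    ∫ r : Fin n → ℝ,
      f r * Complex.exp (-Complex.I * ((fun i => (ζ i : ℂ)) ⬝ᵥ fun i => (r i : ℂ)))

/-- The Wigner-Ville distribution. -/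
def WVD {n : ℕ} (f : (Fin n → ℝ) → ℂ) (r ζ : Fin n → ℝ) : ℂ :=
  ((2 * Real.pi : ℝ) : ℂ) ^ (-(n : ℂ) / 2) *
    ∫ ξ : Fin n → ℝ,
      f (fun i => r i - ξ i / 2) * (starRingEnd ℂ) (f (fun i => r i + ξ i / 2)) *
        Complex.exp (-Complex.I * ((fun i => (ζ i : ℂ)) ⬝ᵥ fun i => (ξ i : ℂ)))

end AHGPaper

namespace AHGPaper

open scoped ContDiff

variable {n : ℕ}

theorem cpderiv_eq {f : (Fin n → ℂ) → ℂ} (hf : ContDiff ℂ ∞ f) (j : Fin n) :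
    cpderiv j f = fun x => fderiv ℂ f x (Pi.single j 1) := by
  funext x
  have h1 : HasFDerivAt f (fderiv ℂ f x) (Function.update x j (x j)) := by
    rw [Function.update_eq_self]
    exact (hf.differentiable (by simp) x).hasFDerivAt
  exact (h1.comp_hasDerivAt (x j) (hasDerivAt_update x j (x j))).deriv

theorem cpderiv_smooth {f : (Fin n → ℂ) → ℂ} (hf : ContDiff ℂ ∞ f) (j : Fin n) :
    ContDiff ℂ ∞ (cpderiv j f) := by
  rw [cpderiv_eq hf]
  exact (hf.fderiv_right (by simp)).clm_apply contDiff_const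

theorem cpderiv_add {f g : (Fin n → ℂ) → ℂ} (hf : ContDiff ℂ ∞ f) (hg : ContDiff ℂ ∞ g)
    (j : Fin n) : cpderiv j (fun x => f x + g x) = fun x => cpderiv j f x + cpderiv j g x := by
  rw [cpderiv_eq (hf.add hg), cpderiv_eq hf, cpderiv_eq hg]
  funext x
  rw [fderiv_fun_add (hf.differentiable (by simp) x) (hg.differentiable (by simp) x)]
  rfl

theorem cpderiv_mul {f g : (Fin n → ℂ) → ℂ} (hf : ContDiff ℂ ∞ f) (hg : ContDiff ℂ ∞ g)
    (j : Fin n) : cpderiv j (fun x => f x * g x) =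
      fun x => cpderiv j f x * g x + f x * cpderiv j g x := by
  rw [cpderiv_eq (hf.mul hg), cpderiv_eq hf, cpderiv_eq hg]
  funext x
  rw [fderiv_fun_mul (hf.differentiable (by simp) x) (hg.differentiable (by simp) x)]
  simp
  ring

theorem cpderiv_const (c : ℂ) (j : Fin n) :
    cpderiv j (fun _ => c) = fun _ => 0 := by
  funext x
  simp [cpderiv]

theorem cpderiv_const_mul {f : (Fin n → ℂ) → ℂ} (hf : ContDiff ℂ ∞ f) (c : ℂ)
    (j : Fin n) : cpderiv j (fun x => c * f x) = fun x => c * cpderiv j f x := by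
  rw [cpderiv_mul contDiff_const hf, cpderiv_const]
  simp

theorem cpderiv_sum {ι : Type*} (s : Finset ι) {f : ι → (Fin n → ℂ) → ℂ}
    (hf : ∀ i, ContDiff ℂ ∞ (f i)) (j : Fin n) :
    cpderiv j (fun x => ∑ i ∈ s, f i x) = fun x => ∑ i ∈ s, cpderiv j (f i) x := by
  classical
  induction s using Finset.induction_on with
  | empty => simpa using cpderiv_const 0 j
  | insert a s ha ih =>
    simp only [Finset.sum_insert ha]
    rw [cpderiv_add (hf a) (ContDiff.sum fun i _ => hf i), ih]

theorem coord_smooth (l : Fin n) : ContDiff ℂ ∞ (fun x : Fin n → ℂ => x l) := by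
  fun_prop

theorem cpderiv_coord (l j : Fin n) :
    cpderiv j (fun x => x l) = fun _ => if j = l then 1 else 0 := by
  funext x
  rcases eq_or_ne j l with h | h
  · subst h; simp [cpderiv]
  · simp [cpderiv, h, Function.update_of_ne (Ne.symm h)]

theorem cpderiv_exp {f : (Fin n → ℂ) → ℂ} (hf : ContDiff ℂ ∞ f) (j : Fin n) :
    cpderiv j (fun x => Complex.exp (f x)) = fun x => Complex.exp (f x) * cpderiv j f x := by
  rw [cpderiv_eq hf.cexp, cpderiv_eq hf]
  funext x
  rw [((hf.differentiable (by simp) x).hasFDerivAt.cexp).fderiv]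
  simp

theorem cpderiv_comm {f : (Fin n → ℂ) → ℂ} (hf : ContDiff ℂ ∞ f) (j k : Fin n) :
    cpderiv j (cpderiv k f) = cpderiv k (cpderiv j f) := by
  have key : ∀ a b : Fin n, cpderiv a (cpderiv b f) =
      fun x => fderiv ℂ (fderiv ℂ f) x (Pi.single a 1) (Pi.single b 1) := by
    intro a b
    rw [cpderiv_eq (cpderiv_smooth hf b), cpderiv_eq hf]
    funext x
    have h : DifferentiableAt ℂ (fderiv ℂ f) x :=
      ((hf.fderiv_right (m := ∞) (by simp)).differentiable (by simp)) x
    rw [fderiv_clm_apply h (by fun_prop)]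
    simp
  rw [key, key]
  funext x
  have := (hf.contDiffAt (x := x)).isSymmSndFDerivAt (by
    simp only [minSmoothness_of_isRCLikeNormedField]; exact WithTop.coe_le_coe.2 le_top)
  exact this _ _

theorem iter_smooth {f : (Fin n → ℂ) → ℂ} (hf : ContDiff ℂ ∞ f) (j : Fin n) (m : ℕ) :
    ContDiff ℂ ∞ ((cpderiv j)^[m] f) := by
  induction m with
  | zero => exact hf
  | succ m ih => rw [Function.iterate_succ_apply']; exact cpderiv_smooth ih j

theorem iter_comm {f : (Fin n → ℂ) → ℂ} (hf : ContDiff ℂ ∞ f) (j k : Fin n) (m : ℕ) :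
    cpderiv k ((cpderiv j)^[m] f) = (cpderiv j)^[m] (cpderiv k f) := by
  induction m with
  | zero => rfl
  | succ m ih =>
    rw [Function.iterate_succ_apply', Function.iterate_succ_apply',
      cpderiv_comm (iter_smooth hf j m), ih]

theorem iter_add {f g : (Fin n → ℂ) → ℂ} (hf : ContDiff ℂ ∞ f) (hg : ContDiff ℂ ∞ g)
    (j : Fin n) (m : ℕ) : (cpderiv j)^[m] (fun x => f x + g x) =
      fun x => (cpderiv j)^[m] f x + (cpderiv j)^[m] g x := by
  induction m with
  | zero => rfl
  | succ m ih =>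
    simp only [Function.iterate_succ_apply', ih]
    rw [cpderiv_add (iter_smooth hf j m) (iter_smooth hg j m)]

theorem iter_const_mul {f : (Fin n → ℂ) → ℂ} (hf : ContDiff ℂ ∞ f) (c : ℂ)
    (j : Fin n) (m : ℕ) : (cpderiv j)^[m] (fun x => c * f x) =
      fun x => c * (cpderiv j)^[m] f x := by
  induction m with
  | zero => rfl
  | succ m ih =>
    simp only [Function.iterate_succ_apply', ih]
    rw [cpderiv_const_mul (iter_smooth hf j m)]

theorem iter_coord {f : (Fin n → ℂ) → ℂ} (hf : ContDiff ℂ ∞ f) (l j : Fin n) (m : ℕ) :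
    (cpderiv j)^[m] (fun x => x l * f x) =
      fun x => x l * (cpderiv j)^[m] f x +
        (if j = l then (m : ℂ) else 0) * (cpderiv j)^[m - 1] f x := by
  induction m with
  | zero => simp
  | succ m ih =>
    rw [Function.iterate_succ_apply', ih,
      cpderiv_add ((coord_smooth l).mul (iter_smooth hf j m))
        (contDiff_const.mul (iter_smooth hf j (m-1))),
      cpderiv_mul (coord_smooth l) (iter_smooth hf j m),
      cpderiv_const_mul (iter_smooth hf j (m-1)), cpderiv_coord]
    funext x
    simp only [Function.iterate_succ_apply', Nat.add_sub_cancel]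
    split_ifs with h
    · rcases m with _ | m
      · simp; ring
      · simp only [Nat.add_sub_cancel, Function.iterate_succ_apply']
        push_cast
        ring
    · simp

/-- list version of the mixed partial derivative -/
def lp (L : List (Fin n)) (ν : Fin n → ℕ) (f : (Fin n → ℂ) → ℂ) : (Fin n → ℂ) → ℂ :=
  L.foldr (fun j g => (cpderiv j)^[ν j] g) f

theorem lp_cons (a : Fin n) (L : List (Fin n)) (ν : Fin n → ℕ) (f : (Fin n → ℂ) → ℂ) :
    lp (a :: L) ν f = (cpderiv a)^[ν a] (lp L ν f) := rfl

theorem lp_smooth {f : (Fin n → ℂ) → ℂ} (hf : ContDiff ℂ ∞ f) (L : List (Fin n))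
    (ν : Fin n → ℕ) : ContDiff ℂ ∞ (lp L ν f) := by
  induction L with
  | nil => exact hf
  | cons a L ih => exact iter_smooth ih a _

theorem lp_comm {f : (Fin n → ℂ) → ℂ} (hf : ContDiff ℂ ∞ f) (L : List (Fin n))
    (ν : Fin n → ℕ) (k : Fin n) : cpderiv k (lp L ν f) = lp L ν (cpderiv k f) := by
  induction L with
  | nil => rfl
  | cons a L ih => rw [lp_cons, lp_cons, iter_comm (lp_smooth hf L ν), ih]

theorem lp_add {f g : (Fin n → ℂ) → ℂ} (hf : ContDiff ℂ ∞ f) (hg : ContDiff ℂ ∞ g)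
    (L : List (Fin n)) (ν : Fin n → ℕ) :
    lp L ν (fun x => f x + g x) = fun x => lp L ν f x + lp L ν g x := by
  induction L with
  | nil => rfl
  | cons a L ih =>
    simp only [lp_cons, ih]
    rw [iter_add (lp_smooth hf L ν) (lp_smooth hg L ν)]

theorem lp_const_mul {f : (Fin n → ℂ) → ℂ} (hf : ContDiff ℂ ∞ f) (c : ℂ)
    (L : List (Fin n)) (ν : Fin n → ℕ) :
    lp L ν (fun x => c * f x) = fun x => c * lp L ν f x := by
  induction L with
  | nil => rfl
  | cons a L ih =>
    simp only [lp_cons, ih]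
    rw [iter_const_mul (lp_smooth hf L ν)]

theorem lp_sum {ι : Type*} (s : Finset ι) {f : ι → (Fin n → ℂ) → ℂ}
    (hf : ∀ i, ContDiff ℂ ∞ (f i)) (L : List (Fin n)) (ν : Fin n → ℕ) :
    lp L ν (fun x => ∑ i ∈ s, f i x) = fun x => ∑ i ∈ s, lp L ν (f i) x := by
  classical
  induction s using Finset.induction_on with
  | empty =>
    have := lp_const_mul (n := n) (f := fun _ => 0) contDiff_const 0 L ν
    simpa using this
  | insert a s ha ih =>
    simp only [Finset.sum_insert ha]
    rw [lp_add (hf a) (ContDiff.sum fun i _ => hf i), ih]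

/-- lowered multi-index -/
abbrev low (ν : Fin n → ℕ) (l : Fin n) : Fin n → ℕ := fun j => ν j - if j = l then 1 else 0

theorem lp_low_of_notMem {L : List (Fin n)} {l : Fin n} (h : l ∉ L) (ν : Fin n → ℕ)
    (f : (Fin n → ℂ) → ℂ) : lp L (low ν l) f = lp L ν f := by
  induction L with
  | nil => rfl
  | cons a L ih =>
    simp only [List.mem_cons, not_or] at h
    rw [lp_cons, lp_cons, ih h.2]
    simp [low, Ne.symm h.1]

theorem lp_coord {f : (Fin n → ℂ) → ℂ} (hf : ContDiff ℂ ∞ f) (l : Fin n) (L : List (Fin n))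
    (hL : L.Nodup) (ν : Fin n → ℕ) :
    lp L ν (fun x => x l * f x) =
      fun x => x l * lp L ν f x + (if l ∈ L then (ν l : ℂ) else 0) * lp L (low ν l) f x := by
  induction L with
  | nil => simp [lp]
  | cons a L ih =>
    rw [List.nodup_cons] at hL
    rw [lp_cons, ih hL.2, iter_add ((coord_smooth l).mul (lp_smooth hf L ν))
      (contDiff_const.mul (lp_smooth hf L _)), iter_coord (lp_smooth hf L ν),
      iter_const_mul (lp_smooth hf L _)]
    funext x
    simp only [lp_cons]
    rcases eq_or_ne a l with h | h
    · subst h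
      simp [hL.1, lp_low_of_notMem hL.1, low]
    · simp [h, Ne.symm h, low]

theorem mp_eq (ν : Fin n → ℕ) (f : (Fin n → ℂ) → ℂ) :
    mpderiv ν f = lp (List.finRange n) ν f := rfl

theorem quad_smooth (M : Matrix (Fin n) (Fin n) ℂ) :
    ContDiff ℂ ∞ (fun x : Fin n → ℂ => x ⬝ᵥ M.mulVec x) := by
  simp only [dotProduct, mulVec]
  fun_prop

theorem cpderiv_quad (M : Matrix (Fin n) (Fin n) ℂ) (hM : M.IsSymm) (k : Fin n) :
    cpderiv k (fun x : Fin n → ℂ => x ⬝ᵥ M.mulVec x) = fun x => ∑ l, 2 * M k l * x l := by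
  simp only [dotProduct, mulVec]
  have h2 : ∀ i, ContDiff ℂ ∞ (fun x : Fin n → ℂ => ∑ j, M i j * x j) := fun i => by fun_prop
  rw [cpderiv_sum _ (fun i => (coord_smooth i).mul (h2 i))]
  funext x
  have h3 : ∀ i, cpderiv k (fun x : Fin n → ℂ => x i * ∑ j, M i j * x j) x =
      (if k = i then 1 else 0) * (∑ j, M i j * x j) + x i * M k i := by
    intro i
    rw [cpderiv_mul (coord_smooth i) (h2 i), cpderiv_coord,
      cpderiv_sum _ (fun j => contDiff_const.mul (coord_smooth j))]
    simp only [cpderiv_const_mul (coord_smooth _), cpderiv_coord]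
    simp [hM.apply]
  simp only [h3, Finset.sum_add_distrib]
  simp only [ite_mul, one_mul, zero_mul, Finset.sum_ite_eq, Finset.mem_univ, if_true]
  rw [← Finset.sum_add_distrib]
  exact Finset.sum_congr rfl fun l _ => by ring

theorem cpderiv_mp (M : Matrix (Fin n) (Fin n) ℂ) (hM : M.IsSymm) (ν : Fin n → ℕ) (k : Fin n) :
    cpderiv k (mpderiv ν (fun x => Complex.exp (-(x ⬝ᵥ M.mulVec x)))) = fun x =>
      ∑ l, -2 * M k l * (x l * mpderiv ν (fun x => Complex.exp (-(x ⬝ᵥ M.mulVec x))) x +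
        ν l * mpderiv (low ν l) (fun x => Complex.exp (-(x ⬝ᵥ M.mulVec x))) x) := by
  have hG : ContDiff ℂ ∞ (fun x : Fin n → ℂ => Complex.exp (-(x ⬝ᵥ M.mulVec x))) :=
    (quad_smooth M).neg.cexp
  have h1 : cpderiv k (fun x : Fin n → ℂ => Complex.exp (-(x ⬝ᵥ M.mulVec x))) =
      fun x => ∑ l, (-2 * M k l) * (x l * Complex.exp (-(x ⬝ᵥ M.mulVec x))) := by
    rw [cpderiv_exp (quad_smooth M).neg]
    have := cpderiv_const_mul (quad_smooth M) (-1) k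
    simp only [neg_one_mul] at this
    rw [this, cpderiv_quad M hM]
    funext x
    beta_reduce
    rw [← Finset.sum_neg_distrib, Finset.mul_sum]
    exact Finset.sum_congr rfl fun l _ => by ring
  simp only [mp_eq]
  rw [lp_comm hG, h1,
    lp_sum _ (fun l => contDiff_const.mul ((coord_smooth l).mul hG))]
  funext x
  refine Finset.sum_congr rfl fun l _ => ?_
  rw [lp_const_mul ((coord_smooth l).mul hG), lp_coord hG l _ (List.nodup_finRange n)]
  simp

theorem HG_smooth (Θ : Matrix (Fin n) (Fin n) ℂ) (ν : Fin n → ℕ) :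
    ContDiff ℂ ∞ (HG Θ ν) := by
  unfold HG
  exact (contDiff_const.mul (contDiff_const.mul (quad_smooth Θ⁻¹)).cexp).mul
    (lp_smooth (quad_smooth Θ⁻¹).neg.cexp _ _)

/-- normalisation constant -/
def cc (ν : Fin n → ℕ) : ℂ :=
  (-(1 / (Real.sqrt 2 : ℂ))) ^ (∑ j, ν j) * ((∏ j, ((ν j).factorial : ℂ)) ^ (-(1 / 2 : ℂ)))

theorem cc_low (ν : Fin n → ℕ) (l : Fin n) :
    -2 * (ν l : ℂ) * cc ν = 2 * ((1 / (Real.sqrt 2 : ℂ)) * (Real.sqrt (ν l) : ℂ)) * cc (low ν l) := by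
  rcases Nat.eq_zero_or_pos (ν l) with h0 | hpos
  · simp [h0]
  have hs : ∑ j, ν j = (∑ j, low ν l j) + 1 := by
    rw [← Finset.add_sum_erase _ ν (Finset.mem_univ l),
      ← Finset.add_sum_erase _ (low ν l) (Finset.mem_univ l)]
    have : ∑ j ∈ Finset.univ.erase l, low ν l j = ∑ j ∈ Finset.univ.erase l, ν j :=
      Finset.sum_congr rfl fun j hj => by simp [low, Finset.ne_of_mem_erase hj]
    rw [this]; simp [low]; omega
  have hp : ∏ j, (ν j).factorial = ν l * ∏ j, (low ν l j).factorial := by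
    rw [← Finset.mul_prod_erase _ (fun j => (ν j).factorial) (Finset.mem_univ l),
      ← Finset.mul_prod_erase _ (fun j => (low ν l j).factorial) (Finset.mem_univ l)]
    have : ∏ j ∈ Finset.univ.erase l, (low ν l j).factorial
        = ∏ j ∈ Finset.univ.erase l, (ν j).factorial :=
      Finset.prod_congr rfl fun j hj => by simp [low, Finset.ne_of_mem_erase hj]
    rw [this, ← mul_assoc]; simp [low, Nat.mul_factorial_pred hpos.ne']
  have hx : (ν l : ℂ) * (ν l : ℂ) ^ (-(1 / 2 : ℂ)) = (Real.sqrt (ν l) : ℂ) := by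
    have hne : (ν l : ℂ) ≠ 0 := by exact_mod_cast hpos.ne'
    rw [Real.sqrt_eq_rpow, Complex.ofReal_cpow (by positivity)]
    nth_rewrite 1 [← Complex.cpow_one (ν l : ℂ)]
    rw [← Complex.cpow_add _ _ hne]
    push_cast
    norm_num
  unfold cc
  have hp' : ∏ j, ((ν j).factorial : ℂ) = ((ν l : ℕ) : ℂ) *
      ((∏ j, (low ν l j).factorial : ℕ) : ℂ) := by
    exact_mod_cast hp
  rw [hs, hp', Complex.natCast_mul_natCast_cpow, ← hx]
  push_cast
  ring

theorem cpderiv_HG (Θ : Matrix (Fin n) (Fin n) ℂ) (hM : Θ⁻¹.IsSymm) (ν : Fin n → ℕ)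
    (k : Fin n) : cpderiv k (HG Θ ν) =
      fun x => ∑ l, Θ⁻¹ k l * (2 * phiV Θ ν x l - x l * HG Θ ν x) := by
  have hE : ContDiff ℂ ∞ (fun x : Fin n → ℂ => Complex.exp ((1/2 : ℂ) * (x ⬝ᵥ Θ⁻¹.mulVec x))) :=
    (contDiff_const.mul (quad_smooth Θ⁻¹)).cexp
  have hP : ContDiff ℂ ∞ (mpderiv ν (fun x : Fin n → ℂ => Complex.exp (-(x ⬝ᵥ Θ⁻¹.mulVec x)))) :=
    lp_smooth (quad_smooth Θ⁻¹).neg.cexp _ _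
  have h0 : HG Θ ν = fun x => (cc ν * (((Real.pi : ℂ) ^ n * Θ.det) ^ (-(1 / 4 : ℂ)))) *
      (Complex.exp ((1/2 : ℂ) * (x ⬝ᵥ Θ⁻¹.mulVec x)) *
        mpderiv ν (fun x => Complex.exp (-(x ⬝ᵥ Θ⁻¹.mulVec x))) x) := by
    funext x; unfold HG cc; ring
  have hphi : ∀ x l, 2 * phiV Θ ν x l = -2 * (ν l : ℂ) * cc ν *
      (((Real.pi : ℂ) ^ n * Θ.det) ^ (-(1 / 4 : ℂ))) *
      (Complex.exp ((1/2 : ℂ) * (x ⬝ᵥ Θ⁻¹.mulVec x)) *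
        mpderiv (low ν l) (fun x => Complex.exp (-(x ⬝ᵥ Θ⁻¹.mulVec x))) x) := by
    intro x l
    rw [cc_low]
    unfold phiV HG cc; ring
  simp only [hphi]
  rw [h0, cpderiv_const_mul (hE.mul hP), cpderiv_mul hE hP, cpderiv_mp _ hM,
    cpderiv_exp (contDiff_const.mul (quad_smooth Θ⁻¹)), cpderiv_const_mul (quad_smooth Θ⁻¹),
    cpderiv_quad _ hM]
  funext x
  simp only [Finset.mul_sum, Finset.sum_mul, ← Finset.sum_add_distrib]
  exact Finset.sum_congr rfl fun l _ => by ring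

theorem PhiM_eq (Θ : Matrix (Fin n) (Fin n) ℂ) (ν : Fin n → ℕ) (x : Fin n → ℂ) (m l : Fin n) :
    PhiM Θ ν x m l = (Real.sqrt (ν l) : ℂ) * (Real.sqrt (low ν l m : ℕ) : ℂ) *
      HG Θ (low (low ν l) m) x := by
  unfold PhiM
  rw [Matrix.of_apply]
  split_ifs with h
  · subst h
    have h1 : low (low ν m) m = fun l => ν l - if l = m then 2 else 0 := by
      funext j; simp only [low]; split_ifs <;> omega
    rw [h1, Real.sqrt_mul (by positivity)]
    rcases Nat.eq_zero_or_pos (ν m) with h0 | hpos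
    · simp [h0]
    · simp [low, Nat.cast_sub (show 1 ≤ ν m from hpos)]
  · have h1 : low (low ν l) m =
        fun j => ν j - ((if j = m then 1 else 0) + (if j = l then 1 else 0)) := by
      funext j; simp only [low]; split_ifs <;> omega
    rw [h1, Real.sqrt_mul (by positivity)]
    simp [low, h]
    ring_nf
    simp

theorem cpderiv_phi (Θ : Matrix (Fin n) (Fin n) ℂ) (hM : Θ⁻¹.IsSymm) (ν : Fin n → ℕ)
    (j l : Fin n) : cpderiv j (fun x => phiV Θ ν x l) =
      fun x => ∑ m, Θ⁻¹ j m * (PhiM Θ ν x m l - x m * phiV Θ ν x l) := by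
  unfold phiV
  rw [cpderiv_const_mul (HG_smooth _ _), cpderiv_HG Θ hM]
  funext x
  rw [Finset.mul_sum]
  refine Finset.sum_congr rfl fun m _ => ?_
  rw [PhiM_eq]
  unfold phiV
  have h2 : (1 / (Real.sqrt 2 : ℂ)) * (1 / (Real.sqrt 2 : ℂ)) = 1 / 2 := by
    have : (Real.sqrt 2 : ℂ) * (Real.sqrt 2 : ℂ) = 2 := by
      exact_mod_cast Real.mul_self_sqrt (by norm_num : (0:ℝ) ≤ 2)
    rw [div_mul_div_comm, this]; norm_num
  linear_combination (2 * (Real.sqrt (ν l) : ℂ) * Θ⁻¹ j m * (Real.sqrt (low ν l m : ℕ) : ℂ) *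
      HG Θ (low (low ν l) m) x) * h2

theorem phi_smooth (Θ : Matrix (Fin n) (Fin n) ℂ) (ν : Fin n → ℕ) (l : Fin n) :
    ContDiff ℂ ∞ (fun x => phiV Θ ν x l) :=
  contDiff_const.mul (HG_smooth _ _)

theorem hess (Θ : Matrix (Fin n) (Fin n) ℂ) (hM : Θ⁻¹.IsSymm) (ν : Fin n → ℕ)
    (j k : Fin n) (x : Fin n → ℂ) : cpderiv j (cpderiv k (HG Θ ν)) x =
      -(HG Θ ν x) * Θ⁻¹ j k + ∑ l, ∑ m, 2 * (Θ⁻¹ j m * (PhiM Θ ν x m l - x m * phiV Θ ν x l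
        - phiV Θ ν x m * x l + (1/2 * HG Θ ν x) * (x m * x l)) * Θ⁻¹ l k) := by
  rw [cpderiv_HG Θ hM]
  have hs : ∀ l, ContDiff ℂ ∞ (fun x => Θ⁻¹ k l * (2 * phiV Θ ν x l + (-1) * (x l * HG Θ ν x))) :=
    fun l => contDiff_const.mul ((contDiff_const.mul (phi_smooth Θ ν l)).add
      (contDiff_const.mul ((coord_smooth l).mul (HG_smooth Θ ν))))
  have h1 : (fun x => ∑ l, Θ⁻¹ k l * (2 * phiV Θ ν x l - x l * HG Θ ν x)) =
      fun x => ∑ l, Θ⁻¹ k l * (2 * phiV Θ ν x l + (-1) * (x l * HG Θ ν x)) := by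
    funext x; exact Finset.sum_congr rfl fun l _ => by ring
  rw [h1, cpderiv_sum _ hs]
  have h2 : ∀ l, cpderiv j (fun x => Θ⁻¹ k l * (2 * phiV Θ ν x l + (-1) * (x l * HG Θ ν x))) x =
      (if j = l then -(HG Θ ν x) * Θ⁻¹ k l else 0) +
      ∑ m, 2 * (Θ⁻¹ j m * (PhiM Θ ν x m l - x m * phiV Θ ν x l
        - phiV Θ ν x m * x l + (1/2 * HG Θ ν x) * (x m * x l)) * Θ⁻¹ l k) := by
    intro l
    rw [cpderiv_const_mul ((contDiff_const.mul (phi_smooth Θ ν l)).add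
        (contDiff_const.mul ((coord_smooth l).mul (HG_smooth Θ ν)))),
      cpderiv_add (contDiff_const.mul (phi_smooth Θ ν l))
        (contDiff_const.mul ((coord_smooth l).mul (HG_smooth Θ ν))),
      cpderiv_const_mul (phi_smooth Θ ν l),
      cpderiv_const_mul ((coord_smooth l).mul (HG_smooth Θ ν)),
      cpderiv_mul (coord_smooth l) (HG_smooth Θ ν), cpderiv_coord, cpderiv_phi Θ hM,
      cpderiv_HG Θ hM]
    have h3 : (if j = l then -(HG Θ ν x) * Θ⁻¹ k l else 0) =
      Θ⁻¹ k l * (-1 * ((if j = l then 1 else 0) * HG Θ ν x)) := by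
      split_ifs <;> ring
    rw [h3]
    have h4 : ∑ m, 2 * (Θ⁻¹ j m * (PhiM Θ ν x m l - x m * phiV Θ ν x l
        - phiV Θ ν x m * x l + (1/2 * HG Θ ν x) * (x m * x l)) * Θ⁻¹ l k) =
        Θ⁻¹ k l * 2 * (∑ m, Θ⁻¹ j m * (PhiM Θ ν x m l - x m * phiV Θ ν x l)) -
        Θ⁻¹ k l * x l * ∑ m, Θ⁻¹ j m * (2 * phiV Θ ν x m - x m * HG Θ ν x) := by
      rw [Finset.mul_sum, Finset.mul_sum, ← Finset.sum_sub_distrib]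
      refine Finset.sum_congr rfl fun m _ => ?_
      rw [hM.apply k l]
      ring
    rw [h4]
    ring
  simp only [h2, Finset.sum_add_distrib]
  simp [hM.apply j k]

end AHGPaper

open AHGPaper
/-- Hessian matrix of the AHG function. -/
theorem ahg_hessian (n : ℕ) (hn : 1 ≤ n) (Θ : Matrix (Fin n) (Fin n) ℂ)
    (hsym : Θ.IsSymm) (hpd : (Θ.map Complex.re).PosDef)
    (ν : Fin n → ℕ) (r : Fin n → ℝ) :
    (Matrix.of fun j k => cpderiv j (cpderiv k (HG Θ ν)) (fun i => (r i : ℂ))) =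
      (-(HG Θ ν (fun i => (r i : ℂ)))) • Θ⁻¹ +
        (2 : ℂ) • (Θ⁻¹ *
          (PhiM Θ ν (fun i => (r i : ℂ)) -
            Matrix.vecMulVec (fun i => (r i : ℂ)) (phiV Θ ν (fun i => (r i : ℂ))) -
            Matrix.vecMulVec (phiV Θ ν (fun i => (r i : ℂ))) (fun i => (r i : ℂ)) +
            ((1 / 2 : ℂ) * HG Θ ν (fun i => (r i : ℂ))) •
              Matrix.vecMulVec (fun i => (r i : ℂ)) (fun i => (r i : ℂ))) * Θ⁻¹) := by
  have hM : Θ⁻¹.IsSymm := by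
    rw [Matrix.IsSymm, Matrix.transpose_nonsing_inv, hsym.eq]
  ext j k
  rw [Matrix.of_apply, hess Θ hM]
  simp only [Matrix.add_apply, Matrix.smul_apply, Matrix.mul_apply, Matrix.sub_apply,
    Matrix.vecMulVec_apply, smul_eq_mul, Finset.sum_mul, Finset.mul_sum]
end
end

section
/- Product of AHG functions. Let n ≥ 1, let Θ ∈ ℂ^{n×n} be symmetric with positive definite real part, and let ν, μ ∈ ℕⁿ. Then for all r ∈ ℂⁿ: HG_Θ^ν(r) · HG_Θ^μ(r) = √(ν!·μ! / 2^{|ν|+|μ|}) · (πⁿ·det Θ)^{−1/4} · e^{−(1/2)·rᵀΘ⁻¹r} · Σ_Ω ((2Θ⁻¹)^Ω / (Ω!·β!·γ!)) · √(2^{|β|+|γ|}·(β+γ)!) · HG_Θ^{β+γ}(r), where the (finite) sum runs over all multi-index matrices Ω ∈ ℕ^{n×n} such that β = ν − Ω1 and γ = μ − 1ᵀΩ are both multi-indices with non-negative entries (Ω1 denotes the row sums and 1ᵀΩ the column sums of Ω). -/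
open scoped BigOperators
open MeasureTheory Matrix

noncomputable section

namespace AHGPaper

def fo {n : ℕ} {α : Type*} (T : Fin n → α → α) (ν : Fin n → ℕ) (l : List (Fin n)) (f : α) : α :=
  l.foldr (fun j g => (T j)^[ν j] g) f

lemma fo_comm {n : ℕ} {α : Type*} (T : Fin n → α → α)
    (hT : ∀ j k x, T j (T k x) = T k (T j x)) (ν : Fin n → ℕ) (l : List (Fin n)) (f : α) (j : Fin n) :
    T j (fo T ν l f) = fo T ν l (T j f) := by
  induction l with
  | nil => rfl
  | cons a l ih =>
    simp only [fo, List.foldr_cons] at ih ⊢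
    rw [← ih]
    exact ((show Function.Commute (T j) (T a) from fun x => hT j a x).iterate_right (ν a)) _

lemma fo_notMem {n : ℕ} {α : Type*} (T : Fin n → α → α) (ν : Fin n → ℕ) (l : List (Fin n)) (f : α)
    (j : Fin n) (hj : j ∉ l) : fo T (ν + Pi.single j 1) l f = fo T ν l f := by
  induction l with
  | nil => rfl
  | cons a l ih =>
    simp only [List.mem_cons, not_or] at hj
    have := ih hj.2
    simp only [fo, List.foldr_cons] at this ⊢
    rw [this]
    simp [Pi.single_apply, Ne.symm hj.1]

lemma fo_succ {n : ℕ} {α : Type*} (T : Fin n → α → α)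
    (hT : ∀ j k x, T j (T k x) = T k (T j x)) (ν : Fin n → ℕ) (l : List (Fin n)) (hl : l.Nodup)
    (f : α) (j : Fin n) (hj : j ∈ l) :
    fo T (ν + Pi.single j 1) l f = T j (fo T ν l f) := by
  induction l with
  | nil => simp at hj
  | cons a l ih =>
    rw [List.nodup_cons] at hl
    by_cases h : j = a
    · subst h
      have := fo_notMem T ν l f j hl.1
      simp only [fo, List.foldr_cons] at this ⊢
      rw [this]
      simp [Function.iterate_succ_apply']
    · have := ih hl.2 (by simpa [h] using hj)
      simp only [fo, List.foldr_cons] at this ⊢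
      rw [this]
      simp only [Pi.add_apply, Pi.single_apply, Ne.symm h, if_false, add_zero]
      exact ((show Function.Commute (T a) (T j) from fun x => hT a j x).iterate_left (ν a)) _

/-- linear form -/
def yy {n : ℕ} (a : Fin n → Fin n → ℂ) (j : Fin n) : MvPolynomial (Fin n) ℂ :=
  ∑ k, MvPolynomial.C (a j k) * MvPolynomial.X k

def UU {n : ℕ} (a : Fin n → Fin n → ℂ) (j : Fin n) :
    MvPolynomial (Fin n) ℂ →+ MvPolynomial (Fin n) ℂ :=
  (MvPolynomial.pderiv j).toLinearMap.toAddMonoidHom - AddMonoidHom.mulLeft (yy a j)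

lemma UU_apply {n : ℕ} (a : Fin n → Fin n → ℂ) (j : Fin n) (p) :
    UU a j p = MvPolynomial.pderiv j p - yy a j * p := rfl

lemma pderiv_yy {n : ℕ} (a : Fin n → Fin n → ℂ) (j k : Fin n) :
    MvPolynomial.pderiv j (yy a k) = MvPolynomial.C (a k j) := by
  simp [yy, map_sum, Derivation.leibniz, MvPolynomial.pderiv_X, Pi.single_apply]

lemma pderiv_comm {n : ℕ} (j k : Fin n) (p : MvPolynomial (Fin n) ℂ) :
    MvPolynomial.pderiv j (MvPolynomial.pderiv k p) = MvPolynomial.pderiv k (MvPolynomial.pderiv j p) := by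
  have : ⁅(MvPolynomial.pderiv j : Derivation ℂ (MvPolynomial (Fin n) ℂ) (MvPolynomial (Fin n) ℂ)), (MvPolynomial.pderiv k : Derivation ℂ (MvPolynomial (Fin n) ℂ) (MvPolynomial (Fin n) ℂ))⁆ = 0 := by
    apply MvPolynomial.derivation_ext
    intro i
    simp [Derivation.commutator_apply, MvPolynomial.pderiv_X, Pi.single_apply, apply_ite]
  have h2 := congrArg (fun D => D p) this
  simpa [Derivation.commutator_apply, sub_eq_zero] using h2

lemma UU_comm {n : ℕ} (a : Fin n → Fin n → ℂ) (ha : ∀ j k, a j k = a k j) (j k : Fin n) (p) :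
    UU a j (UU a k p) = UU a k (UU a j p) := by
  simp only [UU_apply, map_sub, Derivation.leibniz, pderiv_yy, smul_eq_mul]
  rw [pderiv_comm j k, ha j k]; ring

def KK {n : ℕ} (a : Fin n → Fin n → ℂ) (ν : Fin n → ℕ) : MvPolynomial (Fin n) ℂ :=
  fo (fun j => UU a j) ν (List.finRange n) 1

lemma KK_zero {n : ℕ} (a : Fin n → Fin n → ℂ) : KK a 0 = 1 := by
  unfold KK
  induction List.finRange n with
  | nil => rfl
  | cons b l ih => simpa [fo] using ih

lemma KK_succ {n : ℕ} (a : Fin n → Fin n → ℂ) (ha : ∀ j k, a j k = a k j) (ν : Fin n → ℕ) (j) :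
    KK a (ν + Pi.single j 1) = UU a j (KK a ν) :=
  fo_succ _ (fun j k x => UU_comm a ha j k x) ν _ (List.nodup_finRange n) 1 j (List.mem_finRange j)

lemma mi_induction {n : ℕ} {P : (Fin n → ℕ) → Prop} (h0 : P 0)
    (hs : ∀ ν j, P ν → P (ν + Pi.single j 1)) (ν) : P ν := by
  induction h : ∑ i, ν i generalizing ν with
  | zero =>
    have : ν = 0 := by
      ext i; simpa using (Finset.sum_eq_zero_iff.1 h) i (Finset.mem_univ i)
    rwa [this]
  | succ m ih =>
    have : ∃ j, ν j ≠ 0 := by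
      by_contra! hc
      simp [hc] at h
    obtain ⟨j, hj⟩ := this
    have e : ν = (ν - Pi.single j 1) + Pi.single j 1 := by
      ext i
      by_cases hi : i = j
      · subst hi; simp; omega
      · simp [Pi.single_apply, hi]
    rw [e]
    apply hs
    apply ih
    rw [e] at h
    simp only [Pi.add_apply, Finset.sum_add_distrib] at h
    rw [Finset.sum_pi_single' (M := ℕ) j 1] at h
    simpa using h

lemma pderiv_KK {n : ℕ} (a : Fin n → Fin n → ℂ) (ha : ∀ j k, a j k = a k j) (ν : Fin n → ℕ) (j) :
    MvPolynomial.pderiv j (KK a ν) =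
      - ∑ k, MvPolynomial.C (a j k * ν k) * KK a (ν - Pi.single k 1) := by
  induction ν using mi_induction with
  | h0 => simp [KK_zero]
  | hs ν i ih =>
    have h1 : MvPolynomial.pderiv j (UU a i (KK a ν)) =
        UU a i (MvPolynomial.pderiv j (KK a ν)) - MvPolynomial.C (a j i) * KK a ν := by
      simp only [UU_apply, map_sub, Derivation.leibniz, pderiv_yy, smul_eq_mul]
      rw [pderiv_comm j i, ha j i]; ring
    have hC : ∀ (c : ℂ) p, UU a i (MvPolynomial.C c * p) = MvPolynomial.C c * UU a i p := by
      intro c p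
      simp only [UU_apply, Derivation.leibniz, smul_eq_mul, MvPolynomial.pderiv_C]
      ring
    rw [KK_succ a ha, h1, ih, map_neg, map_sum]
    have key : ∀ k, MvPolynomial.C (a j k * ((ν + Pi.single i 1 : Fin n → ℕ) k : ℕ)) * KK a (ν + Pi.single i 1 - Pi.single k 1)
       = UU a i (MvPolynomial.C (a j k * ν k) * KK a (ν - Pi.single k 1)) +
          if k = i then MvPolynomial.C (a j i) * KK a ν else 0 := by
      intro k
      rw [hC, ← KK_succ a ha]
      by_cases hk : k = i
      · subst hk
        have e1 : ν + Pi.single k 1 - Pi.single k 1 = ν := by ext l; simp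
        rw [e1]
        by_cases h0 : ν k = 0
        · simp [h0]
        · have e2 : ν - Pi.single k 1 + Pi.single k 1 = ν := by
            ext l
            by_cases hl : l = k
            · subst hl; simp; omega
            · simp [Pi.single_apply, hl]
          rw [e2]
          simp
          ring
      · have e2 : ν + Pi.single i 1 - Pi.single k 1 = ν - Pi.single k 1 + Pi.single i 1 := by
          ext l
          by_cases hl : l = k
          · subst hl; simp [Pi.single_apply, hk]
          · simp [Pi.single_apply, hl]
        rw [e2]
        simp [Pi.single_apply, hk]
    rw [Finset.sum_congr rfl (fun k _ => key k), Finset.sum_add_distrib]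
    simp
    ring

def dF {n : ℕ} (ν ρ : Fin n → ℕ) : ℕ := ∏ i, (ν i).descFactorial (ρ i)

def ww {n : ℕ} (a : Fin n → Fin n → ℂ) (Ω : Fin n → Fin n → ℕ) : ℂ :=
  ∏ j, ∏ k, a j k ^ Ω j k / ((Ω j k).factorial : ℂ)

def rs {n : ℕ} (Ω : Fin n → Fin n → ℕ) : Fin n → ℕ := fun j => ∑ k, Ω j k
def cs {n : ℕ} (Ω : Fin n → Fin n → ℕ) : Fin n → ℕ := fun k => ∑ j, Ω j k
def EE {n : ℕ} (j k : Fin n) : Fin n → Fin n → ℕ := Pi.single j (Pi.single k 1)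

lemma EE_apply {n : ℕ} (j k j' k' : Fin n) : EE j k j' k' = if j' = j ∧ k' = k then 1 else 0 := by
  unfold EE
  by_cases h : j' = j
  · subst h; simp [Pi.single_apply]
  · simp [h]

lemma rs_add {n : ℕ} (Ω : Fin n → Fin n → ℕ) (j k) : rs (Ω + EE j k) = rs Ω + Pi.single j 1 := by
  ext i
  simp only [rs, Pi.add_apply, Finset.sum_add_distrib, EE_apply, Pi.single_apply]
  by_cases h : i = j <;> simp [h]

lemma cs_add {n : ℕ} (Ω : Fin n → Fin n → ℕ) (j k) : cs (Ω + EE j k) = cs Ω + Pi.single k 1 := by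
  ext i
  simp only [cs, Pi.add_apply, Finset.sum_add_distrib, EE_apply, Pi.single_apply]
  by_cases h : i = k <;> simp [h]

lemma ww_succ {n : ℕ} (a : Fin n → Fin n → ℂ) (Ω : Fin n → Fin n → ℕ) (j k) :
    ((Ω j k : ℂ) + 1) * ww a (Ω + EE j k) = a j k * ww a Ω := by
  unfold ww
  have hs : ∀ f : Fin n → Fin n → ℂ, ∏ x, ∏ y, f x y = f j k * ∏ p ∈ (Finset.univ : Finset (Fin n × Fin n)).erase (j, k), f p.1 p.2 := by
    intro f
    rw [Finset.mul_prod_erase _ (fun p : Fin n × Fin n => f p.1 p.2) (Finset.mem_univ (j, k)), Fintype.prod_prod_type]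
  rw [hs, hs]
  rw [← mul_assoc, ← mul_assoc]
  congr 1
  · simp only [Pi.add_apply, EE_apply, and_self, if_true, Nat.factorial_succ, pow_succ]
    have h1 : ((Ω j k : ℂ) + 1) ≠ 0 := by exact_mod_cast Nat.succ_ne_zero (Ω j k)
    have h2 : ((Ω j k).factorial : ℂ) ≠ 0 := by exact_mod_cast Nat.factorial_ne_zero (Ω j k)
    push_cast
    field_simp
  · apply Finset.prod_congr rfl
    rintro ⟨x, y⟩ hx
    have : ¬ (x = j ∧ y = k) := by simpa using Finset.ne_of_mem_erase hx
    simp [EE_apply, this]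

lemma desc_aux (m r : ℕ) : (m + 1).descFactorial r = m.descFactorial r + r * m.descFactorial (r - 1) := by
  cases r with
  | zero => simp
  | succ r =>
    rw [Nat.succ_descFactorial_succ, Nat.descFactorial_succ, Nat.add_sub_cancel]
    by_cases h : r ≤ m
    · obtain ⟨d, rfl⟩ := Nat.exists_eq_add_of_le h
      simp; ring
    · rw [Nat.descFactorial_of_lt (by omega : m < r)]; simp

lemma dF_split {n : ℕ} (ν ρ : Fin n → ℕ) (j) :
    dF ν ρ = (ν j).descFactorial (ρ j) * ∏ i ∈ Finset.univ.erase j, (ν i).descFactorial (ρ i) :=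
  (Finset.mul_prod_erase _ (fun i => (ν i).descFactorial (ρ i)) (Finset.mem_univ j)).symm

lemma dF_a {n : ℕ} (ν ρ : Fin n → ℕ) (j) :
    dF (ν + Pi.single j 1) ρ = dF ν ρ + ρ j * dF ν (ρ - Pi.single j 1) := by
  rw [dF_split _ _ j, dF_split ν ρ j, dF_split ν (ρ - Pi.single j 1) j]
  have e1 : ∏ i ∈ Finset.univ.erase j, ((ν + Pi.single j 1 : Fin n → ℕ) i).descFactorial (ρ i) =
      ∏ i ∈ Finset.univ.erase j, (ν i).descFactorial (ρ i) :=
    Finset.prod_congr rfl fun i hi => by simp [Finset.ne_of_mem_erase hi]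
  have e2 : ∏ i ∈ Finset.univ.erase j, (ν i).descFactorial ((ρ - Pi.single j 1 : Fin n → ℕ) i) =
      ∏ i ∈ Finset.univ.erase j, (ν i).descFactorial (ρ i) :=
    Finset.prod_congr rfl fun i hi => by simp [Finset.ne_of_mem_erase hi]
  rw [e1, e2]
  simp only [Pi.add_apply, Pi.sub_apply, Pi.single_eq_same, desc_aux]
  ring

lemma dF_b {n : ℕ} (ν ρ : Fin n → ℕ) (j) :
    dF ν (ρ + Pi.single j 1) = ν j * dF (ν - Pi.single j 1) ρ := by
  rw [dF_split _ _ j, dF_split (ν - Pi.single j 1) ρ j]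
  rw [← mul_assoc]
  congr 1
  · simp only [Pi.add_apply, Pi.sub_apply, Pi.single_eq_same]
    cases ν j with
    | zero => simp
    | succ m => rw [Nat.succ_descFactorial_succ, Nat.add_sub_cancel]
  · exact Finset.prod_congr rfl fun i hi => by simp [Finset.ne_of_mem_erase hi]

lemma dF_ne {n : ℕ} {ν ρ : Fin n → ℕ} (h : dF ν ρ ≠ 0) (i) : ρ i ≤ ν i := by
  by_contra! hc
  exact h (Finset.prod_eq_zero (Finset.mem_univ i) (Nat.descFactorial_of_lt hc))

def FF {n : ℕ} (a : Fin n → Fin n → ℂ) (ν μ : Fin n → ℕ) (Ω : Fin n → Fin n → ℕ) :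
    MvPolynomial (Fin n) ℂ :=
  MvPolynomial.C (ww a Ω * dF ν (rs Ω) * dF μ (cs Ω)) * KK a ((ν - rs Ω) + (μ - cs Ω))

def GG {n : ℕ} (a : Fin n → Fin n → ℂ) (ν μ : Fin n → ℕ) (j k : Fin n) (Ω : Fin n → Fin n → ℕ) :
    MvPolynomial (Fin n) ℂ :=
  MvPolynomial.C (Ω j k * ww a Ω * dF ν (rs Ω - Pi.single j 1) * dF μ (cs Ω)) *
    KK a ((ν + Pi.single j 1 - rs Ω) + (μ - cs Ω))

lemma le_cs {n : ℕ} (Ω : Fin n → Fin n → ℕ) (j k) : Ω j k ≤ cs Ω k :=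
  Finset.single_le_sum (f := fun i => Ω i k) (fun _ _ => Nat.zero_le _) (Finset.mem_univ j)

lemma fin_aux {n : ℕ} (μ : Fin n → ℕ) (f : (Fin n → Fin n → ℕ) → MvPolynomial (Fin n) ℂ)
    (h : ∀ Ω, dF μ (cs Ω) = 0 → f Ω = 0) : (Function.support f).Finite := by
  apply (Set.finite_Iic (fun (_ : Fin n) k => μ k)).subset
  intro Ω hΩ j k
  exact (le_cs Ω j k).trans (dF_ne (fun h0 => hΩ (h Ω h0)) k)

lemma FF_fin {n : ℕ} (a : Fin n → Fin n → ℂ) (ν μ : Fin n → ℕ) : (Function.support (FF a ν μ)).Finite :=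
  fin_aux μ _ fun Ω h => by simp [FF, h]

lemma GG_fin {n : ℕ} (a : Fin n → Fin n → ℂ) (ν μ : Fin n → ℕ) (j k) : (Function.support (GG a ν μ j k)).Finite :=
  fin_aux μ _ fun Ω h => by simp [GG, h]

lemma UU_C {n : ℕ} (a : Fin n → Fin n → ℂ) (i) (c : ℂ) (p) :
    UU a i (MvPolynomial.C c * p) = MvPolynomial.C c * UU a i p := by
  simp only [UU_apply, Derivation.leibniz, smul_eq_mul, MvPolynomial.pderiv_C]
  ring

lemma FF_step {n : ℕ} (a : Fin n → Fin n → ℂ) (ha : ∀ j k, a j k = a k j) (ν μ : Fin n → ℕ) (j) (Ω) :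
    FF a (ν + Pi.single j 1) μ Ω = UU a j (FF a ν μ Ω) + ∑ k, GG a ν μ j k Ω := by
  have h1 : UU a j (FF a ν μ Ω) = MvPolynomial.C (ww a Ω * dF ν (rs Ω) * dF μ (cs Ω)) *
      KK a ((ν + Pi.single j 1 - rs Ω) + (μ - cs Ω)) := by
    unfold FF
    rw [UU_C, ← KK_succ a ha]
    by_cases h : dF ν (rs Ω) = 0
    · simp [h]
    · congr 2
      ext i
      have := dF_ne h i
      simp only [Pi.add_apply, Pi.sub_apply]
      omega
  have h2 : ∑ k, GG a ν μ j k Ω = MvPolynomial.C ((rs Ω j : ℕ) * ww a Ω * dF ν (rs Ω - Pi.single j 1) * dF μ (cs Ω)) *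
    KK a ((ν + Pi.single j 1 - rs Ω) + (μ - cs Ω)) := by
    unfold GG
    rw [← Finset.sum_mul, ← map_sum, ← Finset.sum_mul, ← Finset.sum_mul, ← Finset.sum_mul]
    simp [rs]
  rw [h1, h2, FF, dF_a, ← add_mul, ← map_add]
  congr 2
  push_cast
  ring

lemma GG_shift {n : ℕ} (a : Fin n → Fin n → ℂ) (ν μ : Fin n → ℕ) (j k) (Ω) :
    GG a ν μ j k (Ω + EE j k) = MvPolynomial.C (a j k * μ k) * FF a ν (μ - Pi.single k 1) Ω := by
  unfold GG FF
  rw [rs_add, cs_add, dF_b, ← mul_assoc, ← map_mul]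
  congr 2
  · simp only [Pi.add_apply, EE_apply, and_self, if_true, add_tsub_cancel_right]
    push_cast
    rw [ww_succ]; ring
  · ext i
    simp only [Pi.add_apply, Pi.sub_apply]
    omega

lemma GG_sum {n : ℕ} (a : Fin n → Fin n → ℂ) (ν μ : Fin n → ℕ) (j k) :
    ∑ᶠ Ω, GG a ν μ j k Ω = MvPolynomial.C (a j k * μ k) * ∑ᶠ Ω, FF a ν (μ - Pi.single k 1) Ω := by
  rw [mul_finsum' _ _ (FF_fin _ _ _)]
  simp_rw [← GG_shift]
  rw [← finsum_mem_range (f := GG a ν μ j k) (g := fun Ω => Ω + EE j k) (add_left_injective _)]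
  rw [← finsum_mem_univ]
  apply finsum_mem_inter_support_eq
  ext Ω
  simp only [Set.mem_inter_iff, Set.mem_univ, true_and, Set.mem_range, Function.mem_support]
  refine ⟨fun h => ⟨⟨Ω - EE j k, ?_⟩, h⟩, fun h => h.2⟩
  have h0 : Ω j k ≠ 0 := fun h0 => h (by simp [GG, h0])
  ext x y
  simp only [Pi.add_apply, Pi.sub_apply, EE_apply]
  split_ifs with hh
  · rw [hh.1, hh.2]; omega
  · simp

lemma KK_mul {n : ℕ} (a : Fin n → Fin n → ℂ) (ha : ∀ j k, a j k = a k j) (ν μ : Fin n → ℕ) :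
    KK a ν * KK a μ = ∑ᶠ Ω, FF a ν μ Ω := by
  induction ν using mi_induction generalizing μ with
  | h0 =>
    rw [finsum_eq_single _ 0]
    · have h1 : rs (0 : Fin n → Fin n → ℕ) = 0 := by ext; simp [rs]
      have h2 : cs (0 : Fin n → Fin n → ℕ) = 0 := by ext; simp [cs]
      simp [FF, h1, h2, KK_zero, ww, dF]
    · intro Ω hΩ
      have : dF 0 (rs Ω) = 0 := by
        by_contra h
        apply hΩ
        ext j k
        have := dF_ne h j
        simpa using (Finset.sum_eq_zero_iff.1 (Nat.le_zero.1 this)) k (Finset.mem_univ k)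
      simp [FF, this]
  | hs ν j ih =>
    have h1 : UU a j (KK a ν) * KK a μ = UU a j (KK a ν * KK a μ) -
        KK a ν * MvPolynomial.pderiv j (KK a μ) := by
      simp only [UU_apply, Derivation.leibniz, smul_eq_mul]; ring
    rw [KK_succ a ha, h1, pderiv_KK a ha, ih]
    rw [finsum_congr (FF_step a ha ν μ j), finsum_add_distrib, finsum_sum_comm, AddMonoidHom.map_finsum _ (FF_fin _ _ _)]
    · rw [mul_neg, sub_neg_eq_add, Finset.mul_sum]
      congr 1
      apply Finset.sum_congr rfl
      intro k _
      rw [GG_sum, ← ih]; ring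
    · intro k _
      exact GG_fin _ _ _ _ _
    · exact fin_aux μ _ fun Ω h => by simp [FF, h]
    · exact fin_aux μ _ fun Ω h => Finset.sum_eq_zero fun k _ => by simp [GG, h]

lemma hasDeriv_eval {n : ℕ} (p : MvPolynomial (Fin n) ℂ) (x : Fin n → ℂ) (j : Fin n) :
    HasDerivAt (fun t : ℂ => MvPolynomial.eval (Function.update x j t) p)
      (MvPolynomial.eval x (MvPolynomial.pderiv j p)) (x j) := by
  induction p using MvPolynomial.induction_on with
  | C c => simpa using hasDerivAt_const (x j) c
  | add p q hp hq =>
    simp only [map_add]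
    exact hp.add hq
  | mul_X p i hp =>
    have hX : HasDerivAt (fun t : ℂ => Function.update x j t i) (if i = j then 1 else 0) (x j) := by
      by_cases h : i = j
      · subst h; simpa using hasDerivAt_id' (x i)
      · simpa [h] using hasDerivAt_const (x j) (x i)
    have := hp.mul hX
    simp only [map_mul, MvPolynomial.eval_X]
    refine this.congr_deriv ?_
    simp only [Function.update_eq_self, Derivation.leibniz, smul_eq_mul, map_add, map_mul,
      MvPolynomial.pderiv_X, MvPolynomial.eval_X, Pi.single_apply]
    by_cases h : i = j
    · subst h; simp; ring
    · simp [h, Ne.symm h]; ring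

def QQ {n : ℕ} (A : Matrix (Fin n) (Fin n) ℂ) : MvPolynomial (Fin n) ℂ :=
  ∑ i, MvPolynomial.X i * ∑ k, MvPolynomial.C (A i k) * MvPolynomial.X k

lemma eval_QQ {n : ℕ} (A : Matrix (Fin n) (Fin n) ℂ) (x : Fin n → ℂ) :
    MvPolynomial.eval x (QQ A) = x ⬝ᵥ A.mulVec x := by
  simp [QQ, dotProduct, Matrix.mulVec]

lemma pderiv_QQ {n : ℕ} (A : Matrix (Fin n) (Fin n) ℂ) (hA : ∀ j k, A j k = A k j) (j) :
    MvPolynomial.pderiv j (QQ A) = yy (fun j k => 2 * A j k) j := by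
  simp only [QQ, yy, map_sum, Derivation.leibniz, MvPolynomial.pderiv_X, Pi.single_apply,
    MvPolynomial.pderiv_C, smul_eq_mul, Finset.sum_add_distrib, mul_zero, add_zero, mul_ite, mul_one,
    Finset.sum_ite_eq, Finset.sum_ite_eq', Finset.mem_univ, if_true, map_mul]
  rw [← Finset.sum_add_distrib]
  refine Finset.sum_congr rfl fun k _ => ?_
  rw [hA k j, show (MvPolynomial.C (2 : ℂ) : MvPolynomial (Fin n) ℂ) = 2 from map_ofNat _ 2]
  ring

lemma cpderiv_eval {n : ℕ} (A : Matrix (Fin n) (Fin n) ℂ) (hA : ∀ j k, A j k = A k j) (j)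
    (p : MvPolynomial (Fin n) ℂ) :
    cpderiv j (fun x => MvPolynomial.eval x p * Complex.exp (-(x ⬝ᵥ A.mulVec x))) =
      fun x => MvPolynomial.eval x (UU (fun j k => 2 * A j k) j p) *
        Complex.exp (-(x ⬝ᵥ A.mulVec x)) := by
  ext x
  unfold cpderiv
  simp_rw [← eval_QQ]
  have h := (hasDeriv_eval p x j).mul (hasDeriv_eval (QQ A) x j).neg.cexp
  refine h.deriv.trans ?_
  simp only [Pi.neg_apply, Function.update_eq_self, pderiv_QQ A hA, UU_apply, map_sub, map_mul]
  ring

lemma mpderiv_eval {n : ℕ} (A : Matrix (Fin n) (Fin n) ℂ) (hA : ∀ j k, A j k = A k j)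
    (ν : Fin n → ℕ) :
    mpderiv ν (fun x => Complex.exp (-(x ⬝ᵥ A.mulVec x))) =
      fun x => MvPolynomial.eval x (KK (fun j k => 2 * A j k) ν) *
        Complex.exp (-(x ⬝ᵥ A.mulVec x)) := by
  unfold mpderiv KK fo
  induction List.finRange n with
  | nil => simp
  | cons b l ih =>
    simp only [List.foldr_cons]
    rw [ih]
    generalize List.foldr _ _ _ = p
    induction ν b with
    | zero => simp
    | succ m ihm => rw [Function.iterate_succ_apply', Function.iterate_succ_apply', ihm, cpderiv_eval A hA]

lemma cpow_aux (m : ℕ) : (m : ℂ) ^ (-(1 / 2 : ℂ)) = ((Real.sqrt m : ℝ) : ℂ)⁻¹ := by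
  rw [Complex.cpow_neg, Real.sqrt_eq_rpow, Complex.ofReal_cpow (Nat.cast_nonneg m)]
  simp

lemma HG_eq {n : ℕ} (Θ : Matrix (Fin n) (Fin n) ℂ) (hA : ∀ j k, Θ⁻¹ j k = Θ⁻¹ k j)
    (ν : Fin n → ℕ) (r : Fin n → ℂ) :
    HG Θ ν r = (-1) ^ (∑ j, ν j) * ((Real.sqrt 2 : ℂ) ^ (∑ j, ν j))⁻¹ *
      ((Real.sqrt ((∏ j, (ν j).factorial : ℕ) : ℝ) : ℝ) : ℂ)⁻¹ *
      (((Real.pi : ℂ) ^ n * Θ.det) ^ (-(1 / 4 : ℂ))) *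
      Complex.exp (-(1 / 2 : ℂ) * (r ⬝ᵥ Θ⁻¹.mulVec r)) *
      MvPolynomial.eval r (KK (fun j k => 2 * Θ⁻¹ j k) ν) := by
  unfold HG
  rw [mpderiv_eval _ hA, ← cpow_aux]
  have h1 : Complex.exp (-(1 / 2 : ℂ) * (r ⬝ᵥ Θ⁻¹.mulVec r)) =
      Complex.exp ((1 / 2 : ℂ) * (r ⬝ᵥ Θ⁻¹.mulVec r)) * Complex.exp (-(r ⬝ᵥ Θ⁻¹.mulVec r)) := by
    rw [← Complex.exp_add]; congr 1; ring
  have h2 : (-(1 / (Real.sqrt 2 : ℂ))) ^ (∑ j, ν j) =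
      (-1) ^ (∑ j, ν j) * ((Real.sqrt 2 : ℂ) ^ (∑ j, ν j))⁻¹ := by
    rw [← inv_pow, ← mul_pow]; congr 1; ring
  rw [h1, h2]
  push_cast
  ring

lemma dF_fact {n : ℕ} {ν ρ : Fin n → ℕ} (h : ∀ i, ρ i ≤ ν i) :
    (∏ j, (ν j - ρ j).factorial) * dF ν ρ = ∏ j, (ν j).factorial := by
  unfold dF
  rw [← Finset.prod_mul_distrib]
  exact Finset.prod_congr rfl fun i _ => Nat.factorial_mul_descFactorial (h i)

lemma ww_eq {n : ℕ} (a : Fin n → Fin n → ℂ) (Ω : Fin n → Fin n → ℕ) :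
    ww a Ω = (∏ j, ∏ k, a j k ^ Ω j k) / ((∏ j, ∏ k, (Ω j k).factorial : ℕ) : ℂ) := by
  unfold ww
  push_cast
  simp only [Finset.prod_div_distrib]

lemma sqrt_two_pow (m : ℕ) : Real.sqrt (2 ^ m) = Real.sqrt 2 ^ m := by
  induction m with
  | zero => simp
  | succ m ih => rw [pow_succ, pow_succ, Real.sqrt_mul (by positivity), ih]

lemma sq_aux (m : ℕ) : ((Real.sqrt m : ℝ) : ℂ) * ((Real.sqrt m : ℝ) : ℂ) = m := by
  rw [← Complex.ofReal_mul, Real.mul_self_sqrt (Nat.cast_nonneg m)]; simp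

lemma final_aux (N1 N2 M T : ℕ) (s f g h c e k w W b d D1 D2 : ℂ) (hM : N1 + N2 = M + 2 * T)
    (hs : s ≠ 0) (hf : f ≠ 0) (hg : g ≠ 0) (hh : h ≠ 0) (hb : b ≠ 0) (hd : d ≠ 0) (hW : W ≠ 0)
    (hfb : b * D1 = f * f) (hgd : d * D2 = g * g) :
    ((-1) ^ N1 * (s ^ N1)⁻¹ * f⁻¹ * c * e) * ((-1) ^ N2 * (s ^ N2)⁻¹ * g⁻¹ * c * e) *
      (w / W * D1 * D2 * k) =
    f * g / s ^ (N1 + N2) * c * e * (w / (W * b * d) * (s ^ M * h) *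
      ((-1) ^ M * (s ^ M)⁻¹ * h⁻¹ * c * e * k)) := by
  have e1 : (-1 : ℂ) ^ M = (-1) ^ N1 * (-1) ^ N2 := by
    rw [← pow_add, hM, pow_add, pow_mul]; simp
  have e2 : D1 = f * f / b := by field_simp; linear_combination hfb
  have e3 : D2 = g * g / d := by field_simp; linear_combination hgd
  rw [e1, e2, e3, pow_add]
  field_simp

end AHGPaper

open AHGPaper
/-- product of two AHG functions. -/
theorem ahg_product (n : ℕ) (hn : 1 ≤ n) (Θ : Matrix (Fin n) (Fin n) ℂ)
    (hsym : Θ.IsSymm) (hpd : (Θ.map Complex.re).PosDef)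
    (ν μ : Fin n → ℕ) (r : Fin n → ℂ) :
    HG Θ ν r * HG Θ μ r =
      (Real.sqrt ((((∏ j, (ν j).factorial : ℕ) : ℝ) * ((∏ j, (μ j).factorial : ℕ) : ℝ)) /
          2 ^ ((∑ j, ν j) + (∑ j, μ j))) : ℂ) *
        ((Real.pi : ℂ) ^ n * Θ.det) ^ (-(1 / 4) : ℂ) *
        Complex.exp (-(1 / 2 : ℂ) * (r ⬝ᵥ Θ⁻¹.mulVec r)) *
        ∑ᶠ (Ω : Matrix (Fin n) (Fin n) ℕ)
          (_ : (∀ j, ∑ k, Ω j k ≤ ν j) ∧ ∀ k, ∑ j, Ω j k ≤ μ k),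
          ((∏ j, ∏ k, (2 * Θ⁻¹ j k) ^ Ω j k) /
              (((∏ j, ∏ k, (Ω j k).factorial : ℕ) : ℂ) *
                ((∏ j, (ν j - ∑ k, Ω j k).factorial : ℕ) : ℂ) *
                ((∏ k, (μ k - ∑ j, Ω j k).factorial : ℕ) : ℂ))) *
            (Real.sqrt ((2 ^ ((∑ j, (ν j - ∑ k, Ω j k)) + (∑ k, (μ k - ∑ j, Ω j k))) *
                ∏ j, ((ν j - ∑ k, Ω j k) + (μ j - ∑ i, Ω i j)).factorial : ℕ) : ℝ) : ℂ) *
            HG Θ (fun j => (ν j - ∑ k, Ω j k) + (μ j - ∑ i, Ω i j)) r := by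
  have hA : ∀ j k, Θ⁻¹ j k = Θ⁻¹ k j := fun j k => by
    have h : (Θ⁻¹)ᵀ = Θ⁻¹ := by rw [Matrix.transpose_nonsing_inv, hsym.eq]
    exact (congrFun (congrFun h k) j)
  have key := congrArg (MvPolynomial.eval r) (KK_mul (fun j k => 2 * Θ⁻¹ j k)
    (fun j k => by rw [hA]) ν μ)
  have hmap := AddMonoidHom.map_finsum (MvPolynomial.eval r).toAddMonoidHom
    (FF_fin (fun j k => 2 * Θ⁻¹ j k) ν μ)
  rw [map_mul] at key
  replace key := key.trans hmap
  rw [HG_eq Θ hA ν, HG_eq Θ hA μ]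
  have assoc : ∀ x y p q : ℂ, (x * p) * (y * q) = x * y * (p * q) := fun x y p q => by ring
  rw [assoc]
  refine (congrArg _ key).trans ?_
  rw [mul_finsum, mul_finsum]
  refine finsum_congr fun Ω => ?_
  by_cases hP : (∀ j, ∑ k, Ω j k ≤ ν j) ∧ ∀ k, ∑ j, Ω j k ≤ μ k
  · rw [finsum_eq_if, if_pos hP, HG_eq Θ hA]
    have h1 : Real.sqrt ((((∏ j, (ν j).factorial : ℕ) : ℝ) * ((∏ j, (μ j).factorial : ℕ) : ℝ)) /
          2 ^ ((∑ j, ν j) + (∑ j, μ j))) = Real.sqrt ((∏ j, (ν j).factorial : ℕ) : ℝ) *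
          Real.sqrt ((∏ j, (μ j).factorial : ℕ) : ℝ) / Real.sqrt 2 ^ ((∑ j, ν j) + (∑ j, μ j)) := by
      rw [Real.sqrt_div (by positivity), Real.sqrt_mul (by positivity), sqrt_two_pow]
    have h2 : ∀ m k : ℕ, Real.sqrt ((2 ^ m * k : ℕ) : ℝ) = Real.sqrt 2 ^ m * Real.sqrt (k : ℝ) := by
      intro m k
      push_cast
      rw [Real.sqrt_mul (by positivity), sqrt_two_pow]
    rw [h1, h2]
    have hsum : ∑ j, ((ν j - ∑ k, Ω j k) + (μ j - ∑ i, Ω i j)) =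
        (∑ j, (ν j - ∑ k, Ω j k)) + (∑ k, (μ k - ∑ j, Ω j k)) := Finset.sum_add_distrib
    rw [hsum]
    change _ * MvPolynomial.eval r (FF _ _ _ _) = _
    rw [FF, map_mul, MvPolynomial.eval_C, ww_eq]
    have hne : ∀ m : ℕ, m ≠ 0 → ((Real.sqrt (m : ℝ) : ℝ) : ℂ) ≠ 0 := by
      intro m hm
      have : (0 : ℝ) < m := by exact_mod_cast Nat.pos_of_ne_zero hm
      exact_mod_cast (Real.sqrt_pos.2 this).ne'
    have hpf : ∀ f : Fin n → ℕ, ∏ j, (f j).factorial ≠ 0 := fun f =>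
      Finset.prod_ne_zero_iff.2 fun j _ => Nat.factorial_ne_zero _
    simp only [Complex.ofReal_mul, Complex.ofReal_div, Complex.ofReal_pow]
    refine final_aux (∑ j, ν j) (∑ j, μ j) _ (∑ j, ∑ k, Ω j k) _ _ _ _ _ _ _ _ _ _ _ _ _ ?_ ?_
      (hne _ (hpf _)) (hne _ (hpf _)) (hne _ (hpf _)) (Nat.cast_ne_zero.2 (hpf _))
      (Nat.cast_ne_zero.2 (hpf _)) ?_ ?_ ?_
    · have e1 : ∑ j, ν j = ∑ j, (ν j - ∑ k, Ω j k) + ∑ j, ∑ k, Ω j k := by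
        rw [← Finset.sum_add_distrib]
        exact Finset.sum_congr rfl fun j _ => (Nat.sub_add_cancel (hP.1 j)).symm
      have e2 : ∑ j, μ j = ∑ k, (μ k - ∑ j, Ω j k) + ∑ j, ∑ k, Ω j k := by
        rw [Finset.sum_comm (f := fun j k => Ω j k), ← Finset.sum_add_distrib]
        exact Finset.sum_congr rfl fun j _ => (Nat.sub_add_cancel (hP.2 j)).symm
      omega
    · exact_mod_cast hne 2 (by norm_num)
    · exact Nat.cast_ne_zero.2 (Finset.prod_ne_zero_iff.2 fun j _ => hpf _)
    · rw [sq_aux, ← Nat.cast_mul]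
      exact congrArg _ (dF_fact (ρ := rs Ω) hP.1)
    · rw [sq_aux, ← Nat.cast_mul]
      exact congrArg _ (dF_fact (ρ := cs Ω) hP.2)
  · rw [finsum_eq_if, if_neg hP]
    change _ * MvPolynomial.eval r (FF _ _ _ _) = _
    have : FF (fun j k => 2 * Θ⁻¹ j k) ν μ Ω = 0 := by
      by_cases h1 : dF ν (rs Ω) = 0
      · simp [FF, h1]
      · by_cases h2 : dF μ (cs Ω) = 0
        · simp [FF, h2]
        · exact absurd ⟨dF_ne h1, dF_ne h2⟩ hP
    rw [this]; simp
end
end
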